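/- arXiv:1407.7949 — 2 statements merged into one kernel-verified Lean document; each statement's English description precedes it below -/
import Mathlib

section
/- Let A ∈ M_n(ℂ) have complex eigenvalues λ₁,…,λ_n listed with algebraic multiplicity, let r ≥ 1, and let H_n^r(ℂ) be the complex vector space of maps ℂⁿ → ℂⁿ each of whose components is a homogeneous polynomial of degree r in n variables. Then the set of eigenvalues of the linear operator 𝓛 : H_n^r(ℂ) → H_n^r(ℂ), defined by 𝓛h(x) = A·h(x) − h(Ax), is exactly { λ_j − λ₁^{m₁}⋯λ_n^{m_n} : m = (m₁,…,m_n) ∈ ℤ₊ⁿ, |m| = r, j ∈ {1,…,n} }. -/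
open Matrix MvPolynomial

/-- A vector killed by a product of linear factors in `B` yields an eigenvector, staying inside any
predicate stable under the factors. -/
theorem joint_aux {n : ℕ} {R : Type*} [CommRing R] (B : Matrix (Fin n) (Fin n) R)
    (c : Fin n → R) (P : (Fin n → R) → Prop)
    (hP : ∀ h i, P h → P (B *ᵥ h - c i • h)) (s : Finset (Fin n)) :
    ∀ v : Fin n → R, v ≠ 0 → P v →
      (Polynomial.aeval B (∏ i ∈ s, (Polynomial.X - Polynomial.C (c i)))) *ᵥ v = 0 →
      ∃ w, w ≠ 0 ∧ P w ∧ ∃ i, B *ᵥ w = c i • w := by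
  classical
  induction s using Finset.induction_on with
  | empty =>
    intro v hv _ h
    simp at h
    exact absurd h hv
  | insert a s ha ih =>
    intro v hv hPv h
    by_cases h0 : B *ᵥ v - c a • v = 0
    · exact ⟨v, hv, hPv, a, sub_eq_zero.1 h0⟩
    · refine ih _ h0 (hP v a hPv) ?_
      rw [Finset.prod_insert ha, mul_comm, map_mul, ← Matrix.mulVec_mulVec] at h
      have e : Polynomial.aeval B (Polynomial.X - Polynomial.C (c a)) *ᵥ v
          = B *ᵥ v - c a • v := by
        rw [map_sub, Polynomial.aeval_X, Polynomial.aeval_C, Matrix.sub_mulVec,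
          Algebra.algebraMap_eq_smul_one, Matrix.smul_mulVec, Matrix.one_mulVec]
      rwa [e] at h

theorem joint {n : ℕ} (A : Matrix (Fin n) (Fin n) ℂ) (lam : Fin n → ℂ)
    (hchar : A.charpoly = ∏ i, (Polynomial.X - Polynomial.C (lam i)))
    (P : (Fin n → MvPolynomial (Fin n) ℂ) → Prop)
    (hP : ∀ h i, P h →
      P (A.map (C : ℂ →+* MvPolynomial (Fin n) ℂ) *ᵥ h - (C (lam i) : MvPolynomial (Fin n) ℂ) • h))
    (v : Fin n → MvPolynomial (Fin n) ℂ) (hv : v ≠ 0) (hPv : P v) :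
    ∃ w, w ≠ 0 ∧ P w ∧ ∃ i, A.map (C : ℂ →+* MvPolynomial (Fin n) ℂ) *ᵥ w
      = (C (lam i) : MvPolynomial (Fin n) ℂ) • w := by
  refine joint_aux _ (fun i => C (lam i)) P hP Finset.univ v hv hPv ?_
  have h1 := Matrix.aeval_self_charpoly (A.map (C : ℂ →+* MvPolynomial (Fin n) ℂ))
  rw [Matrix.charpoly_map, hchar, Polynomial.map_prod] at h1
  simp only [Polynomial.map_sub, Polynomial.map_X, Polynomial.map_C] at h1
  rw [h1, Matrix.zero_mulVec]

theorem pderiv_bind_aux {n : ℕ} (f : Fin n → MvPolynomial (Fin n) ℂ) (k : Fin n)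
    (p : MvPolynomial (Fin n) ℂ) :
    pderiv k (bind₁ f p) = ∑ i, pderiv k (f i) * bind₁ f (pderiv i p) := by
  classical
  induction p using MvPolynomial.induction_on with
  | C a => simp
  | add p q hp hq => simp [hp, hq, mul_add, Finset.sum_add_distrib]
  | mul_X p j hp =>
    have h1 : ∀ i, pderiv k (f i) * bind₁ f (pderiv i (p * X j)) =
        pderiv k (f i) * bind₁ f (pderiv i p) * f j +
          (if i = j then pderiv k (f j) * bind₁ f p else 0) := by
      intro i
      rw [pderiv_mul, map_add, map_mul, map_mul, bind₁_X_right]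
      split_ifs with hij
      · subst hij
        rw [pderiv_X_self, map_one]
        ring
      · rw [pderiv_X_of_ne (Ne.symm hij), map_zero]
        ring
    rw [Finset.sum_congr rfl fun i _ => h1 i, Finset.sum_add_distrib, ← Finset.sum_mul, ← hp,
      Finset.sum_ite_eq' Finset.univ j, if_pos (Finset.mem_univ j), map_mul, bind₁_X_right,
      pderiv_mul]
    ring

theorem exists_eigvec {n : ℕ} (A : Matrix (Fin n) (Fin n) ℂ) (lam : Fin n → ℂ)
    (hchar : A.charpoly = ∏ i, (Polynomial.X - Polynomial.C (lam i))) (j : Fin n) :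
    ∃ v : Fin n → ℂ, v ≠ 0 ∧ A *ᵥ v = lam j • v := by
  have h := Matrix.eval_charpoly A (lam j)
  rw [hchar, Polynomial.eval_prod, Finset.prod_eq_zero (Finset.mem_univ j) (by simp)] at h
  obtain ⟨v, hv, h2⟩ := Matrix.exists_mulVec_eq_zero_iff.2 h.symm
  refine ⟨v, hv, ?_⟩
  rw [Matrix.sub_mulVec, sub_eq_zero] at h2
  rw [← h2]
  ext i
  simp [Matrix.mulVec_diagonal]

/-- Substitution `h(x) ↦ h(Ax)`. -/
noncomputable abbrev subst {n : ℕ} (A : Matrix (Fin n) (Fin n) ℂ) :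
    MvPolynomial (Fin n) ℂ →ₐ[ℂ] MvPolynomial (Fin n) ℂ :=
  bind₁ (fun i => ∑ k, C (A i k) * (X k : MvPolynomial (Fin n) ℂ))

theorem subst_mulVec {n : ℕ} (A B : Matrix (Fin n) (Fin n) ℂ)
    (h : Fin n → MvPolynomial (Fin n) ℂ) :
    (fun j => subst A ((B.map (C : ℂ →+* MvPolynomial (Fin n) ℂ) *ᵥ h) j)) =
      B.map (C : ℂ →+* MvPolynomial (Fin n) ℂ) *ᵥ (fun j => subst A (h j)) := by
  ext1 j
  simp [Matrix.mulVec, dotProduct]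

theorem hom_step {n r : ℕ} (B : Matrix (Fin n) (Fin n) ℂ) (c : ℂ)
    (h : Fin n → MvPolynomial (Fin n) ℂ) (hh : ∀ j, (h j).IsHomogeneous r) (j : Fin n) :
    ((B.map (C : ℂ →+* MvPolynomial (Fin n) ℂ) *ᵥ h
      - (C c : MvPolynomial (Fin n) ℂ) • h) j).IsHomogeneous r := by
  simp only [Pi.sub_apply, Matrix.mulVec, dotProduct, Pi.smul_apply, smul_eq_mul, Matrix.map_apply]
  exact (IsHomogeneous.sum _ _ _ fun i _ => (hh i).C_mul _).sub ((hh j).C_mul _)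

theorem subst_step {n : ℕ} (A B : Matrix (Fin n) (Fin n) ℂ) (c : ℂ)
    (h : Fin n → MvPolynomial (Fin n) ℂ) :
    (fun j => subst A ((B.map (C : ℂ →+* MvPolynomial (Fin n) ℂ) *ᵥ h
      - (C c : MvPolynomial (Fin n) ℂ) • h) j)) =
      B.map (C : ℂ →+* MvPolynomial (Fin n) ℂ) *ᵥ (fun j => subst A (h j))
       - (C c : MvPolynomial (Fin n) ℂ) • (fun j => subst A (h j)) := by
  rw [← subst_mulVec]
  ext1 j
  simp

theorem subst_eig {n : ℕ} (A : Matrix (Fin n) (Fin n) ℂ) (lam : Fin n → ℂ)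
    (hchar : A.charpoly = ∏ i, (Polynomial.X - Polynomial.C (lam i))) (r : ℕ) :
    ∀ (β : ℂ) (p : MvPolynomial (Fin n) ℂ), p ≠ 0 → p.IsHomogeneous r →
      subst A p = C β * p → ∃ m : Fin n → ℕ, ∑ i, m i = r ∧ β = ∏ i, lam i ^ m i := by
  classical
  induction r with
  | zero =>
    intro β p hp hh he
    refine ⟨0, by simp, ?_⟩
    rw [← totalDegree_zero_iff_isHomogeneous, totalDegree_eq_zero_iff_eq_C] at hh
    rw [hh] at he hp
    simp only [subst, bind₁_C_right, ← C_mul] at he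
    have h1 := C_injective _ _ he
    have h2 : coeff 0 p ≠ 0 := fun h => hp (by rw [h, C_0])
    simp only [Pi.zero_apply, pow_zero, Finset.prod_const_one]
    exact mul_right_cancel₀ h2 (by rw [one_mul, ← h1])
  | succ r ih =>
    intro β p hp hh he
    have hcharT : (Aᵀ).charpoly = ∏ i, (Polynomial.X - Polynomial.C (lam i)) := by
      rw [Matrix.charpoly_transpose, hchar]
    obtain ⟨w, hw, ⟨hw1, hw2⟩, i, hi⟩ := joint Aᵀ lam hcharT
      (fun w => (∀ j, (w j).IsHomogeneous r) ∧
        Aᵀ.map (C : ℂ →+* MvPolynomial (Fin n) ℂ) *ᵥ (fun j => subst A (w j))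
          = (C β : MvPolynomial (Fin n) ℂ) • w)
      (by
        rintro h i ⟨h1, h2⟩
        refine ⟨hom_step _ _ _ h1, ?_⟩
        rw [subst_step, Matrix.mulVec_sub, h2, Matrix.mulVec_smul, Matrix.mulVec_smul, h2,
          smul_sub, smul_comm])
      (fun k => pderiv k p)
      (by
        intro h0
        have h1 := hh.sum_X_mul_pderiv
        have h2 : ∀ k, pderiv k p = 0 := fun k => congrFun h0 k
        simp only [h2, mul_zero, Finset.sum_const_zero] at h1
        exact (smul_ne_zero (Nat.succ_ne_zero r) hp) h1.symm)
      (by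
        refine ⟨fun j => hh.pderiv, ?_⟩
        ext1 k
        have h1 := congrArg (pderiv k) he
        rw [pderiv_bind_aux, pderiv_C_mul] at h1
        simp only [Matrix.mulVec, dotProduct, Pi.smul_apply, smul_eq_mul, Matrix.map_apply,
          Matrix.transpose_apply]
        rw [← h1]
        refine Finset.sum_congr rfl fun i _ => ?_
        congr 1
        rw [map_sum, Finset.sum_eq_single k]
        · simp [pderiv_C_mul]
        · intro b _ hb
          simp [pderiv_C_mul, pderiv_X_of_ne hb]
        · simp)
    obtain ⟨j, hj⟩ := Function.ne_iff.1 hw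
    have h3 : C (lam i) * subst A (w j) = C β * w j := by
      have h4 := subst_mulVec A Aᵀ w
      rw [hi, hw2] at h4
      simpa using congrFun h4 j
    by_cases h0 : lam i = 0
    · refine ⟨Pi.single i (r + 1), by simp, ?_⟩
      rw [h0, C_0, zero_mul] at h3
      have h5 : β = 0 := by
        rcases mul_eq_zero.1 h3.symm with h | h
        · exact (C_eq_zero).1 h
        · exact absurd h hj
      rw [h5, Finset.prod_eq_zero (Finset.mem_univ i)]
      simp [h0]
    · have h6 : subst A (w j) = C (β / lam i) * w j := by
        apply mul_left_cancel₀ (a := (C (lam i) : MvPolynomial (Fin n) ℂ)) (by simpa using h0)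
        rw [h3, ← mul_assoc, ← C_mul, mul_div_cancel₀ _ h0]
      obtain ⟨m, hm, hβ⟩ := ih _ _ hj (hw1 j) h6
      refine ⟨m + Pi.single i 1, by simp [Finset.sum_add_distrib, hm], ?_⟩
      simp only [Pi.add_apply, pow_add, Finset.prod_mul_distrib, ← hβ]
      rw [Finset.prod_eq_single i]
      · simp [h0]
      · intro b _ hb
        simp [Pi.single_apply, hb]
      · simp

theorem subst_exists {n : ℕ} (A : Matrix (Fin n) (Fin n) ℂ) (lam : Fin n → ℂ)
    (hchar : A.charpoly = ∏ i, (Polynomial.X - Polynomial.C (lam i))) (m : Fin n → ℕ) :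
    ∃ p : MvPolynomial (Fin n) ℂ, p ≠ 0 ∧ p.IsHomogeneous (∑ i, m i) ∧
      subst A p = C (∏ i, lam i ^ m i) * p := by
  classical
  have hcharT : (Aᵀ).charpoly = ∏ i, (Polynomial.X - Polynomial.C (lam i)) := by
    rw [Matrix.charpoly_transpose, hchar]
  choose v hv he using exists_eigvec Aᵀ lam hcharT
  let l : Fin n → MvPolynomial (Fin n) ℂ := fun i => ∑ k, C (v i k) * X k
  have hl0 : ∀ i, l i ≠ 0 := by
    intro i h
    apply hv i
    ext k
    have h1 := congrArg (pderiv k) h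
    simp only [l, map_sum, map_zero] at h1
    rw [Finset.sum_eq_single k] at h1
    · simpa [pderiv_C_mul] using h1
    · intro b _ hb
      simp [pderiv_C_mul, pderiv_X_of_ne hb]
    · simp
  have hl1 : ∀ i, (l i).IsHomogeneous 1 := fun i =>
    IsHomogeneous.sum _ _ _ fun k _ => isHomogeneous_C_mul_X _ _
  have hl2 : ∀ i, subst A (l i) = C (lam i) * l i := by
    intro i
    simp only [l, map_sum, map_mul, subst, bind₁_C_right, bind₁_X_right, Finset.mul_sum]
    rw [Finset.sum_comm]
    refine Finset.sum_congr rfl fun k _ => ?_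
    have h1 := congrFun (he i) k
    simp only [Matrix.mulVec, dotProduct, Matrix.transpose_apply, Pi.smul_apply, smul_eq_mul] at h1
    rw [← mul_assoc, ← C_mul, ← h1, map_sum, Finset.sum_mul]
    refine Finset.sum_congr rfl fun j _ => ?_
    rw [C_mul]; ring
  refine ⟨∏ i, l i ^ m i, Finset.prod_ne_zero_iff.2 fun i _ => pow_ne_zero _ (hl0 i),
    IsHomogeneous.prod _ _ _ fun i _ => by simpa using (hl1 i).pow (m i), ?_⟩
  rw [map_prod, map_prod, ← Finset.prod_mul_distrib]
  refine Finset.prod_congr rfl fun i _ => ?_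
  rw [map_pow, hl2, mul_pow, C_pow]



/-- **Spectrum of the operator `𝓛 h(x) = A·h(x) − h(Ax)`** on the space of `n`-dimensional
vector-valued homogeneous polynomials of degree `r`: its set of eigenvalues is exactly
`{ λ_j − λ^m : |m| = r, j = 1,…,n }`, where `λ₁,…,λ_n` are the eigenvalues of `A` with
multiplicity. -/
theorem spectrum_of_diffeo_homological_operator
    {n r : ℕ} (hr : 1 ≤ r)
    (A : Matrix (Fin n) (Fin n) ℂ) (lam : Fin n → ℂ)
    (hchar : A.charpoly = ∏ i, (Polynomial.X - Polynomial.C (lam i))) :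
    {μ : ℂ | ∃ h : Fin n → MvPolynomial (Fin n) ℂ,
        (∀ j, (h j).IsHomogeneous r) ∧
        h ≠ 0 ∧
        (∀ j, (∑ k, C (A j k) * h k) -
            bind₁ (fun i => ∑ k, C (A i k) * (X k : MvPolynomial (Fin n) ℂ)) (h j) =
          C μ * h j)} =
      {μ : ℂ | ∃ m : Fin n → ℕ, (∑ i, m i) = r ∧
        ∃ j : Fin n, μ = lam j - ∏ i, lam i ^ m i} := by

  ext μ
  simp only [Set.mem_setOf_eq]
  constructor
  · rintro ⟨h, hh, h0, he⟩
    obtain ⟨w, hw, ⟨hw1, hw2⟩, i, hi⟩ := joint A lam hchar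
      (fun w => (∀ j, (w j).IsHomogeneous r) ∧
        A.map (C : ℂ →+* MvPolynomial (Fin n) ℂ) *ᵥ w - (fun j => subst A (w j))
          = (C μ : MvPolynomial (Fin n) ℂ) • w)
      (by
        rintro h i ⟨h1, h2⟩
        refine ⟨hom_step _ _ _ h1, ?_⟩
        rw [subst_step, smul_sub, smul_comm (C μ), ← Matrix.mulVec_smul, ← h2,
          Matrix.mulVec_sub, Matrix.mulVec_sub, smul_sub, Matrix.mulVec_smul]
        abel)
      h h0
      ⟨hh, by
        ext1 j
        simpa [Matrix.mulVec, dotProduct] using he j⟩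
    obtain ⟨j, hj⟩ := Function.ne_iff.1 hw
    rw [hi] at hw2
    have h3 := congrFun hw2 j
    simp only [Pi.sub_apply, Pi.smul_apply, smul_eq_mul] at h3
    obtain ⟨m, hm, hβ⟩ := subst_eig A lam hchar r (lam i - μ) (w j) hj (hw1 j) (by
      rw [C_sub, sub_mul, ← h3]; ring)
    exact ⟨m, hm, i, by rw [← hβ]; ring⟩
  · rintro ⟨m, hm, j, rfl⟩
    obtain ⟨p, hp, hph, hpe⟩ := subst_exists A lam hchar m
    obtain ⟨v, hv, hve⟩ := exists_eigvec A lam hchar j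
    refine ⟨fun k => C (v k) * p, fun k => hm ▸ hph.C_mul _, ?_, fun k => ?_⟩
    · intro h
      apply hv
      ext k
      have h1 := congrFun h k
      simpa [hp] using h1
    · have h1 := congrFun hve k
      simp only [Matrix.mulVec, dotProduct, Pi.smul_apply, smul_eq_mul] at h1
      rw [map_mul, bind₁_C_right, hpe, C_sub]
      have h2 : ∑ x, C (A k x) * (C (v x) * p) = C (lam j) * (C (v k) * p) := by
        rw [← mul_assoc, ← C_mul, ← h1, map_sum, Finset.sum_mul]
        exact Finset.sum_congr rfl fun x _ => by rw [C_mul]; ring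
      rw [h2]; ring
end

section
/- Let B ∈ M_n(ℂ) have complex eigenvalues μ₁,…,μ_n listed with algebraic multiplicity, let r ≥ 1, and let H_n^r(ℂ) be the complex vector space of maps ℂⁿ → ℂⁿ each of whose components is a homogeneous polynomial of degree r in n variables. Then the set of eigenvalues of the linear operator L : H_n^r(ℂ) → H_n^r(ℂ), defined by Lh(x) = Dh(x)·Bx − B·h(x), is exactly { m₁μ₁+⋯+m_nμ_n − μ_j : m = (m₁,…,m_n) ∈ ℤ₊ⁿ, |m| = r, j ∈ {1,…,n} }. -/
open Matrix MvPolynomial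

namespace HomOp

/-- The derivation `p ↦ Dp(x) · Bx`. -/
noncomputable def vf {n : ℕ} (B : Matrix (Fin n) (Fin n) ℂ) :
    Derivation ℂ (MvPolynomial (Fin n) ℂ) (MvPolynomial (Fin n) ℂ) :=
  mkDerivation ℂ (fun i => ∑ k, C (B i k) * (X k : MvPolynomial (Fin n) ℂ))

lemma vf_X {n : ℕ} (B : Matrix (Fin n) (Fin n) ℂ) (i : Fin n) :
    vf B (X i) = ∑ k, C (B i k) * (X k : MvPolynomial (Fin n) ℂ) := by
  simp [vf, mkDerivation_X]

lemma der_C {n : ℕ} (D : Derivation ℂ (MvPolynomial (Fin n) ℂ) (MvPolynomial (Fin n) ℂ))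
    (c : ℂ) : D (C c) = 0 := derivation_C D c

lemma der_C_mul {n : ℕ} (D : Derivation ℂ (MvPolynomial (Fin n) ℂ) (MvPolynomial (Fin n) ℂ))
    (c : ℂ) (p : MvPolynomial (Fin n) ℂ) : D (C c * p) = C c * D p := by
  rw [D.leibniz, der_C]; simp

lemma der_sum_apply {n : ℕ} (f : Fin n → MvPolynomial (Fin n) ℂ) (p : MvPolynomial (Fin n) ℂ) :
    (∑ i, f i • pderiv (R := ℂ) i) p = ∑ i, f i * pderiv i p := by
  have key : ∀ s : Finset (Fin n),
      (∑ i ∈ s, f i • pderiv (R := ℂ) i) p = ∑ i ∈ s, f i * pderiv i p := by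
    intro s
    induction s using Finset.induction_on with
    | empty => simp
    | insert a s ha ih =>
      rw [Finset.sum_insert ha, Finset.sum_insert ha, Derivation.add_apply, ih]
      simp
  exact key _

lemma vf_apply {n : ℕ} (B : Matrix (Fin n) (Fin n) ℂ) (p : MvPolynomial (Fin n) ℂ) :
    vf B p = ∑ i, pderiv i p * ∑ k, C (B i k) * (X k : MvPolynomial (Fin n) ℂ) := by
  have h : vf B = ∑ i, (∑ k, C (B i k) * (X k : MvPolynomial (Fin n) ℂ)) • pderiv (R := ℂ) i := by
    refine derivation_ext fun j => ?_
    rw [vf_X, der_sum_apply]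
    simp [pderiv_X, Pi.single_apply]
  rw [h, der_sum_apply]
  exact Finset.sum_congr rfl fun i _ => mul_comm _ _

lemma pderiv_vf {n : ℕ} (B : Matrix (Fin n) (Fin n) ℂ) (k : Fin n) (p : MvPolynomial (Fin n) ℂ) :
    pderiv k (vf B p) = vf B (pderiv k p) + ∑ i, C (B i k) * pderiv i p := by
  have h : ⁅pderiv (R := ℂ) k, vf B⁆ = ∑ i, (C (B i k) : MvPolynomial (Fin n) ℂ) •
      pderiv (R := ℂ) i := by
    refine derivation_ext fun j => ?_
    rw [der_sum_apply, Derivation.commutator_apply, vf_X, map_sum, pderiv_X]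
    have : vf B (Pi.single (M := fun _ => MvPolynomial (Fin n) ℂ) k 1 j) = 0 := by
      by_cases hjk : j = k
      · subst hjk; simp
      · simp [hjk]
    have h2 : ∀ i, pderiv k (C (B j i) * (X i : MvPolynomial (Fin n) ℂ)) =
      C (B j i) * Pi.single (M := fun _ => MvPolynomial (Fin n) ℂ) k 1 i := fun i => by
        rw [der_C_mul, pderiv_X]
    simp only [h2]
    rw [this]
    simp [Pi.single_apply, pderiv_X]
  have h3 := congrArg (fun D => D p) h
  simp only [der_sum_apply, Derivation.commutator_apply] at h3
  rw [← h3]; ring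

/-- One step of Cayley-Hamilton inside an invariant family `W`. -/
lemma exists_eig {n : ℕ} {R : Type*} [CommRing R] (A : Matrix (Fin n) (Fin n) R)
    (mu : Fin n → R) (W : (Fin n → R) → Prop)
    (hW : ∀ h i, W h → W (A *ᵥ h - mu i • h)) (s : Finset (Fin n)) :
    ∀ h, W h → h ≠ 0 →
      (Polynomial.aeval A (∏ i ∈ s, (Polynomial.X - Polynomial.C (mu i)))) *ᵥ h = 0 →
      ∃ i, ∃ g, W g ∧ g ≠ 0 ∧ A *ᵥ g = mu i • g := by
  induction s using Finset.induction_on with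
  | empty =>
    intro h _ h0 h1
    simp at h1
    exact absurd h1 h0
  | insert a s ha ih =>
    intro h hh h0 h1
    by_cases hz : A *ᵥ h - mu a • h = 0
    · exact ⟨a, h, hh, h0, sub_eq_zero.mp hz⟩
    · refine ih _ (hW h a hh) hz ?_
      rw [Finset.prod_insert ha, mul_comm, map_mul, ← mulVec_mulVec] at h1
      have e : (Polynomial.aeval A (Polynomial.X - Polynomial.C (mu a))) *ᵥ h =
          A *ᵥ h - mu a • h := by
        rw [map_sub, Polynomial.aeval_X, Polynomial.aeval_C, sub_mulVec,
          Algebra.algebraMap_eq_smul_one, smul_mulVec, one_mulVec]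
      rw [e] at h1
      exact h1

lemma step {n : ℕ} (B : Matrix (Fin n) (Fin n) ℂ) (mu : Fin n → ℂ)
    (A : Matrix (Fin n) (Fin n) ℂ)
    (hA : A.charpoly = ∏ i, (Polynomial.X - Polynomial.C (mu i))) (c ν : ℂ) (r : ℕ)
    (h : Fin n → MvPolynomial (Fin n) ℂ) (hh : ∀ j, (h j).IsHomogeneous r) (h0 : h ≠ 0)
    (hL : ∀ j, vf B (h j) + C c * ∑ k, C (A j k) * h k = C ν * h j) :
    ∃ i : Fin n, ∃ _ : Fin n, ∃ g : MvPolynomial (Fin n) ℂ, g ≠ 0 ∧ g.IsHomogeneous r ∧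
      vf B g = C (ν - c * mu i) * g := by
  set A' : Matrix (Fin n) (Fin n) (MvPolynomial (Fin n) ℂ) := A.map C with hA'
  have hmv : ∀ (h : Fin n → MvPolynomial (Fin n) ℂ) j, (A' *ᵥ h) j = ∑ k, C (A j k) * h k :=
    fun h j => rfl
  obtain ⟨i, g, ⟨hg1, hg2⟩, hg0, hg⟩ := exists_eig A' (fun i => C (mu i))
    (fun h => (∀ j, (h j).IsHomogeneous r) ∧ ∀ j, vf B (h j) + C c * (A' *ᵥ h) j = C ν * h j)
    (by
      rintro h i ⟨h1, h2⟩
      refine ⟨fun j => ?_, fun j => ?_⟩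
      · rw [Pi.sub_apply, hmv]
        exact (IsHomogeneous.sum _ _ _ fun k _ => (h1 k).C_mul _).sub ((h1 j).C_mul _)
      · rw [mulVec_sub, mulVec_smul]
        simp only [Pi.sub_apply, Pi.smul_apply, smul_eq_mul, map_sub, der_C_mul]
        have e : vf B ((A' *ᵥ h) j) + C c * (A' *ᵥ (A' *ᵥ h)) j = C ν * (A' *ᵥ h) j := by
          rw [hmv h j, hmv _ j, map_sum, Finset.mul_sum, Finset.mul_sum,
            ← Finset.sum_add_distrib]
          refine Finset.sum_congr rfl fun k _ => ?_
          rw [der_C_mul]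
          linear_combination C (A j k) * h2 k
        linear_combination e - C (mu i) * h2 j)
    Finset.univ h ⟨hh, hL⟩ h0 (by
      have e : A'.charpoly = ∏ i, (Polynomial.X - Polynomial.C (C (mu i))) := by
        rw [hA', charpoly_map, hA, Polynomial.map_prod]
        simp
      rw [← e, aeval_self_charpoly, zero_mulVec])
  obtain ⟨j, hj⟩ := Function.ne_iff.mp hg0
  refine ⟨i, j, g j, hj, hg1 j, ?_⟩
  have h2 := hg2 j
  rw [hg] at h2
  simp only [Pi.smul_apply, smul_eq_mul] at h2
  rw [C_sub, C_mul]
  linear_combination h2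

lemma main {n : ℕ} (B : Matrix (Fin n) (Fin n) ℂ) (mu : Fin n → ℂ)
    (hB : B.charpoly = ∏ i, (Polynomial.X - Polynomial.C (mu i))) (r : ℕ) :
    ∀ (A : Matrix (Fin n) (Fin n) ℂ)
      (_ : A.charpoly = ∏ i, (Polynomial.X - Polynomial.C (mu i))) (c ν : ℂ)
      (h : Fin n → MvPolynomial (Fin n) ℂ), (∀ j, (h j).IsHomogeneous r) → h ≠ 0 →
      (∀ j, vf B (h j) + C c * ∑ k, C (A j k) * h k = C ν * h j) →
      ∃ m : Fin n → ℕ, (∑ i, m i) = r ∧ ∃ j, ν = (∑ i, (m i : ℂ) * mu i) + c * mu j := by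
  induction r with
  | zero =>
    intro A hA c ν h hh h0 hL
    obtain ⟨i, j, g, hg0, hhom, hD⟩ := step B mu A hA c ν 0 h hh h0 hL
    rw [← totalDegree_zero_iff_isHomogeneous, totalDegree_eq_zero_iff_eq_C] at hhom
    rw [hhom, der_C, ← hhom] at hD
    refine ⟨0, by simp, i, ?_⟩
    have := (mul_eq_zero.mp hD.symm).resolve_right hg0
    rw [C_eq_zero] at this
    simp; linear_combination this
  | succ r ih =>
    intro A hA c ν h hh h0 hL
    obtain ⟨i, j, g, hg0, hhom, hD⟩ := step B mu A hA c ν (r+1) h hh h0 hL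
    obtain ⟨m, hm, l, hl⟩ := ih Bᵀ (by rw [charpoly_transpose, hB]) 1 (ν - c * mu i)
      (fun k => pderiv k g) (fun k => by simpa using hhom.pderiv) (by
        intro hz
        have := hhom.sum_X_mul_pderiv
        have hz' : ∀ k, pderiv k g = 0 := fun k => congrFun hz k
        simp [hz'] at this
        rcases this with h | h
        · norm_cast at h
        · exact hg0 h) (by
        intro k
        have := congrArg (pderiv k) hD
        rw [pderiv_vf, der_C_mul] at this
        simpa using this)
    refine ⟨m + Pi.single l 1, by simp [Finset.sum_add_distrib, hm], i, ?_⟩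
    have : ∀ x, ((Pi.single (M := fun _ => ℕ) l 1 x : ℕ) : ℂ) * mu x = if x = l then mu x else 0 := by
      intro x
      by_cases hx : x = l
      · subst hx; simp
      · simp [hx]
    simp only [Pi.add_apply, Nat.cast_add, add_mul, Finset.sum_add_distrib, this]
    simp
    linear_combination hl

lemma exists_evec {n : ℕ} (B : Matrix (Fin n) (Fin n) ℂ) (mu : Fin n → ℂ)
    (hB : B.charpoly = ∏ i, (Polynomial.X - Polynomial.C (mu i))) (j : Fin n) :
    ∃ v : Fin n → ℂ, v ≠ 0 ∧ B *ᵥ v = mu j • v := by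
  have h : (Matrix.scalar (Fin n) (mu j) - B).det = 0 := by
    rw [← eval_charpoly, hB, Polynomial.eval_prod]
    exact Finset.prod_eq_zero (Finset.mem_univ j) (by simp)
  obtain ⟨v, hv, hv2⟩ := exists_mulVec_eq_zero_iff.mpr h
  refine ⟨v, hv, ?_⟩
  rw [sub_mulVec, sub_eq_zero] at hv2
  rw [← hv2]
  simp [← Matrix.smul_one_eq_diagonal, smul_mulVec]

lemma vf_mul {n : ℕ} (B : Matrix (Fin n) (Fin n) ℂ) {p q : MvPolynomial (Fin n) ℂ} {a b : ℂ}
    (hp : vf B p = C a * p) (hq : vf B q = C b * q) : vf B (p * q) = C (a + b) * (p * q) := by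
  rw [Derivation.leibniz, hp, hq, C_add]; simp only [smul_eq_mul]; ring

lemma vf_pow {n : ℕ} (B : Matrix (Fin n) (Fin n) ℂ) {p : MvPolynomial (Fin n) ℂ} {a : ℂ}
    (hp : vf B p = C a * p) (m : ℕ) : vf B (p ^ m) = C (m * a) * p ^ m := by
  induction m with
  | zero => simp
  | succ m ih =>
    rw [pow_succ, vf_mul B ih hp]
    congr 2; push_cast; ring

lemma vf_prod {n : ℕ} (B : Matrix (Fin n) (Fin n) ℂ) {p : Fin n → MvPolynomial (Fin n) ℂ}
    {a : Fin n → ℂ} (hp : ∀ i, vf B (p i) = C (a i) * p i) (s : Finset (Fin n)) :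
    vf B (∏ i ∈ s, p i) = C (∑ i ∈ s, a i) * ∏ i ∈ s, p i := by
  induction s using Finset.induction_on with
  | empty => simp
  | insert x s hx ih => rw [Finset.prod_insert hx, Finset.sum_insert hx, vf_mul B (hp x) ih]

lemma exists_form {n : ℕ} (B : Matrix (Fin n) (Fin n) ℂ) (mu : Fin n → ℂ)
    (hB : B.charpoly = ∏ i, (Polynomial.X - Polynomial.C (mu i))) (j : Fin n) :
    ∃ p : MvPolynomial (Fin n) ℂ, p ≠ 0 ∧ p.IsHomogeneous 1 ∧ vf B p = C (mu j) * p := by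
  obtain ⟨w, hw, hw2⟩ := exists_evec Bᵀ mu (by rw [charpoly_transpose, hB]) j
  refine ⟨∑ k, C (w k) * X k, ?_, ?_, ?_⟩
  · intro h
    apply hw
    funext l
    have := congrArg (fun p => eval (Pi.single l 1) p) h
    simpa [Pi.single_apply] using this
  · exact IsHomogeneous.sum _ _ _ fun i _ => isHomogeneous_C_mul_X _ _
  · rw [map_sum]
    simp only [der_C_mul, vf_X, Finset.mul_sum]
    rw [Finset.sum_comm]
    refine Finset.sum_congr rfl fun k _ => ?_
    have := congrFun hw2 k
    simp only [mulVec, dotProduct, transpose_apply, Pi.smul_apply, smul_eq_mul] at this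
    rw [← mul_assoc, ← C_mul, ← this, map_sum, Finset.sum_mul]
    refine Finset.sum_congr rfl fun i _ => ?_
    rw [C_mul]; ring

end HomOp

/-- **Spectrum of the operator `L h(x) = Dh(x)·Bx − B·h(x)`** (Bibikov) on the space of
`n`-dimensional vector-valued homogeneous polynomials of degree `r`: its set of eigenvalues
is exactly `{ ⟨m,μ⟩ − μ_j : |m| = r, j = 1,…,n }`, where `μ₁,…,μ_n` are the eigenvalues of
`B` with multiplicity. -/
theorem spectrum_of_vector_field_homological_operator
    {n r : ℕ} (hr : 1 ≤ r)
    (B : Matrix (Fin n) (Fin n) ℂ) (mu : Fin n → ℂ)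
    (hchar : B.charpoly = ∏ i, (Polynomial.X - Polynomial.C (mu i))) :
    {ν : ℂ | ∃ h : Fin n → MvPolynomial (Fin n) ℂ,
        (∀ j, (h j).IsHomogeneous r) ∧
        h ≠ 0 ∧
        (∀ j, (∑ i, pderiv i (h j) * ∑ k, C (B i k) * (X k : MvPolynomial (Fin n) ℂ)) -
            (∑ k, C (B j k) * h k) = C ν * h j)} =
      {ν : ℂ | ∃ m : Fin n → ℕ, (∑ i, m i) = r ∧
        ∃ j : Fin n, ν = (∑ i, (m i : ℂ) * mu i) - mu j} := by
  ext ν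
  simp only [Set.mem_ofPred_eq]
  constructor
  · rintro ⟨h, hh, h0, hL⟩
    obtain ⟨m, hm, j, hj⟩ := HomOp.main B mu hchar r B hchar (-1) ν h hh h0 (fun j => by
      rw [← hL j, HomOp.vf_apply, C_neg, C_1]; ring)
    exact ⟨m, hm, j, by rw [hj]; ring⟩
  · rintro ⟨m, hm, j, rfl⟩
    obtain ⟨v, hv, hv2⟩ := HomOp.exists_evec B mu hchar j
    choose p hp0 hp1 hp2 using HomOp.exists_form B mu hchar
    have hP := HomOp.vf_prod B (fun i => HomOp.vf_pow B (hp2 i) (m i)) Finset.univ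
    have hP0 : ∏ i, p i ^ m i ≠ 0 := Finset.prod_ne_zero_iff.mpr fun i _ => pow_ne_zero _ (hp0 i)
    have hPh : (∏ i, p i ^ m i).IsHomogeneous r := by
      rw [← hm]
      exact IsHomogeneous.prod _ _ _ fun i _ => by simpa using (hp1 i).pow (m i)
    generalize (∏ i, p i ^ m i) = P at hP hP0 hPh
    refine ⟨fun k => C (v k) * P, fun k => hPh.C_mul _, ?_, fun k => ?_⟩
    · obtain ⟨k, hk⟩ := Function.ne_iff.mp hv
      exact Function.ne_iff.mpr ⟨k, mul_ne_zero (by simpa using hk) hP0⟩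
    · have := congrFun hv2 k
      simp only [mulVec, dotProduct, Pi.smul_apply, smul_eq_mul] at this
      rw [← HomOp.vf_apply, HomOp.der_C_mul, hP]
      have e : ∑ l, C (B k l) * (C (v l) * P) = C (mu j * v k) * P := by
        rw [← this, map_sum, Finset.sum_mul]
        exact Finset.sum_congr rfl fun l _ => by rw [C_mul]; ring
      rw [e, C_sub, C_mul]; ring
end
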